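/- Let G be a countable abelian group acting on a probability space (X, 𝓑, μ) such that L²(X, 𝓑, μ) is separable. Then for A_1, A_2, …, A_k ⊆ G and measurable B ⊆ X with μ(B) > 0, one has c(A_1 A_2 ⋯ A_k, B) ≤ Π_{i=1}^k μ(A_i B)/μ(B). -/

import Mathlib

open Filter MeasureTheory Pointwise ENNReal

/-- The magnification ratio `c(A, B) = inf { μ(A B') / μ(B') : B' ⊆ B measurable, μ(B') > 0 }`,
where `A B' = ⋃_{a ∈ A} a • B'`. -/
noncomputable def magRatio {G X : Type*} [SMul G X] [MeasurableSpace X]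
    (μ : Measure X) (A : Set G) (B : Set X) : ℝ≥0∞ :=
  sInf {r : ℝ≥0∞ | ∃ B' : Set X, B' ⊆ B ∧ MeasurableSet B' ∧ 0 < μ B' ∧
    r = μ (A • B') / μ B'}

section helpers

set_option linter.unusedSectionVars false

universe u v

/-- Existence of a minimizer of `ψ - K μ` among measurable subsets of `B`. -/
theorem exists_minimizer {X : Type v} [MeasurableSpace X] (μ : Measure X) [IsProbabilityMeasure μ]
    (ψ : Set X → ℝ) (K : ℝ) (hK : 0 ≤ K) (h0 : ∀ S, 0 ≤ ψ S)
    (hmono : ∀ S T, S ⊆ T → ψ S ≤ ψ T)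
    (hsub : ∀ S T, MeasurableSet S → MeasurableSet T → ψ (S ∪ T) + ψ (S ∩ T) ≤ ψ S + ψ T)
    (hcont : ∀ s : ℕ → Set X, Monotone s → (∀ n, MeasurableSet (s n)) →
      Tendsto (fun n => ψ (s n)) atTop (nhds (ψ (⋃ n, s n))))
    (B : Set X) :
    ∃ S, S ⊆ B ∧ MeasurableSet S ∧ ∀ T, T ⊆ B → MeasurableSet T →
      ψ S - K * μ.real S ≤ ψ T - K * μ.real T := by
  classical
  set φ : Set X → ℝ := fun S => ψ S - K * μ.real S with hφ
  set V : Set ℝ := {r | ∃ S, S ⊆ B ∧ MeasurableSet S ∧ φ S = r} with hV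
  have hne : V.Nonempty := ⟨φ ∅, ∅, Set.empty_subset _, MeasurableSet.empty, rfl⟩
  have hbdd : BddBelow V := by
    refine ⟨-K, ?_⟩
    rintro r ⟨S, -, -, rfl⟩
    have h1 : μ.real S ≤ 1 := measureReal_le_one
    have := h0 S
    simp only [hφ]
    nlinarith
  set m := sInf V with hm
  have hmle : ∀ S, S ⊆ B → MeasurableSet S → m ≤ φ S := fun S h1 h2 =>
    csInf_le hbdd ⟨S, h1, h2, rfl⟩
  have hex : ∀ n : ℕ, ∃ S, S ⊆ B ∧ MeasurableSet S ∧ φ S < m + (1/2)^n := by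
    intro n
    obtain ⟨r, ⟨S, h1, h2, rfl⟩, h3⟩ := exists_lt_of_csInf_lt hne
      (show sInf V < m + (1/2)^n by rw [← hm]; have : (0:ℝ) < (1/2)^n := by positivity
                                    linarith)
    exact ⟨S, h1, h2, h3⟩
  choose s hsB hsm hs using hex
  have hφsub : ∀ S T, S ⊆ B → T ⊆ B → MeasurableSet S → MeasurableSet T →
      φ (S ∪ T) ≤ φ S + φ T - m := by
    intro S T hS hT mS mT
    have h1 := hsub S T mS mT
    have h2 := measureReal_union_add_inter (μ := μ) (s := S) mT
    have h3 := hmle (S ∩ T) (Set.inter_subset_left.trans hS) (mS.inter mT)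
    simp only [hφ] at *
    have h4 : K * μ.real (S ∪ T) + K * μ.real (S ∩ T) = K * μ.real S + K * μ.real T := by
      rw [← mul_add, h2, mul_add]
    linarith
  -- partial unions
  let t : ℕ → ℕ → Set X := fun n j => ⋃ i ∈ Finset.range (j+1), s (n+i)
  have htm : ∀ n j, MeasurableSet (t n j) := fun n j =>
    Finset.measurableSet_biUnion _ (fun i _ => hsm _)
  have htB : ∀ n j, t n j ⊆ B := fun n j => Set.iUnion₂_subset (fun i _ => hsB _)
  have htsucc : ∀ n j, t n (j+1) = t n j ∪ s (n+(j+1)) := by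
    intro n j
    simp only [t]
    rw [Finset.range_add_one, Finset.set_biUnion_insert, Set.union_comm]
  have htφ : ∀ n j, φ (t n j) ≤ m + 2 * (1/2)^n - (1/2)^(n+j) := by
    intro n j
    induction j with
    | zero =>
      have := hs n
      simp only [t]
      simp
      simp at this
      linarith
    | succ j ih =>
      rw [htsucc]
      have h1 := hφsub _ _ (htB n j) (hsB (n+(j+1))) (htm n j) (hsm _)
      have h2 := hs (n+(j+1))
      have h3 : ((1:ℝ)/2)^(n+j) = 2 * (1/2)^(n+(j+1)) := by
        rw [← add_assoc, pow_succ]; ring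
      rw [h3] at ih
      linarith
  let U : ℕ → Set X := fun n => ⋃ j, t n j
  have hUm : ∀ n, MeasurableSet (U n) := fun n => MeasurableSet.iUnion (htm n)
  have hUB : ∀ n, U n ⊆ B := fun n => Set.iUnion_subset (htB n)
  have htmono : ∀ n, Monotone (t n) := fun n => monotone_nat_of_le_succ (fun j => by
    rw [htsucc]; exact Set.subset_union_left)
  have hμcont : ∀ w : ℕ → Set X, Monotone w →
      Tendsto (fun n => μ.real (w n)) atTop (nhds (μ.real (⋃ n, w n))) := by
    intro w hw
    exact (ENNReal.tendsto_toReal (measure_ne_top _ _)).comp (tendsto_measure_iUnion_atTop hw)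
  have hUφ : ∀ n, φ (U n) ≤ m + 2 * (1/2)^n := by
    intro n
    have h1 : Tendsto (fun j => φ (t n j)) atTop (nhds (φ (U n))) :=
      (hcont _ (htmono n) (htm n)).sub ((hμcont _ (htmono n)).const_mul K)
    refine le_of_tendsto h1 (Eventually.of_forall fun j => ?_)
    have := htφ n j
    have h2 : (0:ℝ) < (1/2)^(n+j) := by positivity
    linarith
  have hUanti : Antitone U := by
    intro a b hab x hx
    simp only [U, t, Set.mem_iUnion] at hx ⊢
    obtain ⟨j, i, -, hi⟩ := hx
    refine ⟨b + i - a, b + i - a, by simp, ?_⟩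
    rwa [show a + (b + i - a) = b + i by omega]
  refine ⟨⋂ n, U n, (Set.iInter_subset _ 0).trans (hUB 0), MeasurableSet.iInter hUm, ?_⟩
  have hD : Tendsto (fun n => μ.real (U n)) atTop (nhds (μ.real (⋂ n, U n))) :=
    (ENNReal.tendsto_toReal (measure_ne_top _ _)).comp
      (tendsto_measure_iInter_atTop (fun n => (hUm n).nullMeasurableSet) hUanti
        ⟨0, measure_ne_top _ _⟩)
  have hle : φ (⋂ n, U n) ≤ m := by
    have h1 : Tendsto (fun n => m + 2 * (1/2:ℝ)^n + K * (μ.real (U n) - μ.real (⋂ n, U n)))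
        atTop (nhds (m + 2 * 0 + K * (μ.real (⋂ n, U n) - μ.real (⋂ n, U n)))) := by
      refine Tendsto.add (tendsto_const_nhds.add (Tendsto.const_mul _ ?_))
        ((hD.sub tendsto_const_nhds).const_mul K)
      exact tendsto_pow_atTop_nhds_zero_of_lt_one (by norm_num) (by norm_num)
    have h2 := ge_of_tendsto' h1 (b := φ (⋂ n, U n)) (fun n => by
      have h3 := hUφ n
      have h4 := hmono _ _ (Set.iInter_subset U n)
      simp only [hφ] at h3 ⊢
      linarith)
    simpa using h2
  intro T hT mT
  exact hle.trans (hmle T hT mT)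

variable {G : Type u} {X : Type v} [CommGroup G] [Countable G] [MulAction G X] [MeasurableSpace X]

theorem meas_smul (hmeas : ∀ g : G, Measurable (fun x : X => g • x)) (g : G) {S : Set X}
    (hS : MeasurableSet S) : MeasurableSet (g • S) := by
  have := hmeas g⁻¹ hS
  rwa [Set.preimage_smul, inv_inv] at this

theorem meas_set_smul (hmeas : ∀ g : G, Measurable (fun x : X => g • x)) (A : Set G) {S : Set X}
    (hS : MeasurableSet S) : MeasurableSet (A • S) := by
  rw [← Set.iUnion_smul_set]
  exact MeasurableSet.biUnion (Set.to_countable A) (fun a _ => meas_smul hmeas a hS)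

/-- The lemma of Petridis. -/
theorem petridis (μ : Measure X) [IsProbabilityMeasure μ]
    (hmeas : ∀ g : G, Measurable (fun x : X => g • x))
    (hinv : ∀ (g : G) (S : Set X), MeasurableSet S → μ (g • S) = μ S)
    (ψ : Set X → ℝ) (K : ℝ) (hψ0 : ψ ∅ = 0)
    (hsub : ∀ S T, MeasurableSet S → MeasurableSet T → ψ (S ∪ T) + ψ (S ∩ T) ≤ ψ S + ψ T)
    (hcont : ∀ s : ℕ → Set X, Monotone s → (∀ n, MeasurableSet (s n)) →
      Tendsto (fun n => ψ (s n)) atTop (nhds (ψ (⋃ n, s n))))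
    (hψinv : ∀ (g : G) (S : Set X), MeasurableSet S → ψ (g • S) = ψ S)
    (S : Set X) (hS : MeasurableSet S)
    (hmin : ∀ T, T ⊆ S → MeasurableSet T → ψ S - K * μ.real S ≤ ψ T - K * μ.real T)
    (C : Set G) : ψ (C • S) ≤ K * μ.real (C • S) := by
  classical
  have hfin : ∀ F : Finset G, ψ ((F : Set G) • S) ≤ K * μ.real ((F : Set G) • S) := by
    intro F
    induction F using Finset.induction_on with
    | empty => simp [hψ0]
    | insert c F _ ih =>
      have hU : ((insert c F : Finset G) : Set G) • S = ((F : Set G) • S) ∪ c • S := by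
        rw [Finset.coe_insert, Set.insert_eq, Set.union_smul, Set.singleton_smul, Set.union_comm]
      rw [hU]
      set U := (F : Set G) • S with hUdef
      have mU : MeasurableSet U := meas_set_smul hmeas _ hS
      have mcS : MeasurableSet (c • S) := meas_smul hmeas c hS
      set T := S ∩ c⁻¹ • U with hT
      have mT : MeasurableSet T := hS.inter (meas_smul hmeas _ mU)
      have hcT : U ∩ c • S = c • T := by
        rw [hT, Set.smul_set_inter, smul_inv_smul, Set.inter_comm]
      have h1 := hsub U (c • S) mU mcS
      have h2 := hmin T Set.inter_subset_left mT
      have h3 := measureReal_union_add_inter (μ := μ) (s := U) mcS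
      rw [hcT] at h1 h3
      rw [hψinv c S hS, hψinv c T mT] at h1
      have e1 : μ.real (c • S) = μ.real S := by simp only [Measure.real, hinv c S hS]
      have e2 : μ.real (c • T) = μ.real T := by simp only [Measure.real, hinv c T mT]
      rw [e1, e2] at h3
      have h4 : K * μ.real (U ∪ c • S) + K * μ.real T = K * μ.real U + K * μ.real S := by
        rw [← mul_add, h3, mul_add]
      linarith
  rcases C.eq_empty_or_nonempty with rfl | hne
  · simp [hψ0]
  obtain ⟨f, rfl⟩ := (Set.to_countable C).exists_eq_range hne
  let w : ℕ → Set X := fun n => (((Finset.range n).image f : Finset G) : Set G) • S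
  have hw : Monotone w := by
    intro a b hab
    refine Set.smul_subset_smul_right ?_
    exact_mod_cast Finset.image_subset_image (Finset.range_mono hab)
  have hwm : ∀ n, MeasurableSet (w n) := fun n => meas_set_smul hmeas _ hS
  have hwU : (⋃ n, w n) = Set.range f • S := by
    simp only [w]
    rw [← Set.iUnion_smul]
    congr 1
    ext g
    simp only [Set.mem_iUnion, Finset.coe_image, Set.mem_image, Finset.mem_coe, Finset.mem_range,
      Set.mem_range]
    constructor
    · rintro ⟨n, i, -, rfl⟩; exact ⟨i, rfl⟩
    · rintro ⟨i, rfl⟩; exact ⟨i+1, i, by omega, rfl⟩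
  have h1 := hcont w hw hwm
  have h2 : Tendsto (fun n => K * μ.real (w n)) atTop (nhds (K * μ.real (⋃ n, w n))) :=
    ((ENNReal.tendsto_toReal (measure_ne_top _ _)).comp
      (tendsto_measure_iUnion_atTop hw)).const_mul K
  rw [hwU] at h1 h2
  exact le_of_tendsto_of_tendsto' h1 h2 (fun n => hfin _)

/-- The inequality up to a constant, for nonempty sets. -/
theorem weak_ineq (μ : Measure X) [IsProbabilityMeasure μ]
    (hmeas : ∀ g : G, Measurable (fun x : X => g • x))
    (hinv : ∀ (g : G) (S : Set X), MeasurableSet S → μ (g • S) = μ S)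
    (k : ℕ) (hk : 0 < k) (A : Fin k → Set G) (hA : ∀ i, (A i).Nonempty) (B : Set X)
    (hB : MeasurableSet B) (hB0 : 0 < μ B) :
    magRatio μ (∏ i, A i) B ≤ ENNReal.ofReal ((2 * k) ^ k) * ∏ i, (μ ((A i) • B) / μ B) := by
  classical
  have hBr : 0 < μ.real B := ENNReal.toReal_pos hB0.ne' (measure_ne_top _ _)
  have hABr : ∀ i, 0 < μ.real (A i • B) := by
    intro i
    obtain ⟨a, ha⟩ := hA i
    have h1 : μ.real (a • B) = μ.real B := by simp only [Measure.real, hinv a B hB]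
    have h2 : μ.real (a • B) ≤ μ.real (A i • B) :=
      measureReal_mono (Set.smul_set_subset_smul ha)
    linarith
  set α : Fin k → ℝ := fun i => μ.real (A i • B) / μ.real B with hα
  have hαpos : ∀ i, 0 < α i := fun i => div_pos (hABr i) hBr
  set ψ : Set X → ℝ := fun S => ∑ i, (α i)⁻¹ * μ.real (A i • S) with hψ
  have h0 : ∀ S, 0 ≤ ψ S := fun S => Finset.sum_nonneg fun i _ =>
    mul_nonneg (inv_nonneg.2 (hαpos i).le) measureReal_nonneg
  have hmono : ∀ S T, S ⊆ T → ψ S ≤ ψ T := fun S T h => Finset.sum_le_sum fun i _ =>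
    mul_le_mul_of_nonneg_left (measureReal_mono (Set.smul_subset_smul_left h))
      (inv_nonneg.2 (hαpos i).le)
  have hsub : ∀ S T, MeasurableSet S → MeasurableSet T →
      ψ (S ∪ T) + ψ (S ∩ T) ≤ ψ S + ψ T := by
    intro S T mS mT
    simp only [hψ, ← Finset.sum_add_distrib, ← mul_add]
    refine Finset.sum_le_sum fun i _ => mul_le_mul_of_nonneg_left ?_ (inv_nonneg.2 (hαpos i).le)
    rw [← measureReal_union_add_inter (μ := μ) (s := A i • S) (meas_set_smul hmeas (A i) mT),
      Set.smul_union]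
    have : μ.real (A i • (S ∩ T)) ≤ μ.real (A i • S ∩ A i • T) :=
      measureReal_mono Set.smul_inter_subset
    linarith
  have hcont : ∀ s : ℕ → Set X, Monotone s → (∀ n, MeasurableSet (s n)) →
      Tendsto (fun n => ψ (s n)) atTop (nhds (ψ (⋃ n, s n))) := by
    intro s hs _
    refine tendsto_finsetSum _ fun i _ => Tendsto.const_mul _ ?_
    rw [Set.smul_iUnion]
    exact (ENNReal.tendsto_toReal (measure_ne_top _ _)).comp (tendsto_measure_iUnion_atTop
      (fun a b hab => Set.smul_subset_smul_left (hs hab)))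
  have hψinv : ∀ (g : G) (S : Set X), MeasurableSet S → ψ (g • S) = ψ S := by
    intro g S mS
    refine Finset.sum_congr rfl fun i _ => ?_
    have : A i • g • S = g • (A i • S) := by
      rw [← Set.singleton_smul, ← Set.singleton_smul, smul_smul, smul_smul, mul_comm]
    rw [this]
    simp only [Measure.real, hinv g _ (meas_set_smul hmeas (A i) mS)]
  have hkr : (0:ℝ) < k := by exact_mod_cast hk
  obtain ⟨S, hSB, mS, hmin⟩ := exists_minimizer μ ψ (2 * k) (by positivity) h0 hmono hsub hcont B
  have hSpos : 0 < μ.real S := by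
    have h1 := hmin B le_rfl hB
    have h2 : ψ B = k * μ.real B := by
      simp only [hψ, hα]
      rw [Finset.sum_congr rfl (g := fun _ => μ.real B) (fun i _ => by
        have := (hABr i).ne'
        field_simp)]
      simp
    rw [h2] at h1
    have h3 := h0 S
    have h4 : 0 < (k:ℝ) * μ.real B := by positivity
    by_contra hcon
    have h5 : μ.real S = 0 := le_antisymm (not_lt.1 hcon) measureReal_nonneg
    rw [h5] at h1
    linarith
  have hpet := petridis μ hmeas hinv ψ (2 * k) (by simp [hψ]) hsub hcont hψinv S mS
    (fun T hT mT => hmin T (hT.trans hSB) mT)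
  have hstep : ∀ i (C : Set G), μ.real ((A i * C) • S) ≤ (2 * k * α i) * μ.real (C • S) := by
    intro i C
    have h1 := hpet C
    have h2 : (α i)⁻¹ * μ.real (A i • C • S) ≤ ψ (C • S) :=
      Finset.single_le_sum (f := fun i => (α i)⁻¹ * μ.real (A i • C • S))
        (fun j _ => mul_nonneg (inv_nonneg.2 (hαpos j).le) measureReal_nonneg) (Finset.mem_univ i)
    have h3 := h2.trans h1
    rw [inv_mul_le_iff₀ (hαpos i)] at h3
    rw [← smul_smul]
    linarith
  have hprod : ∀ s : Finset (Fin k), μ.real ((∏ i ∈ s, A i) • S) ≤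
      (∏ i ∈ s, (2 * k * α i)) * μ.real S := by
    intro s
    induction s using Finset.induction_on with
    | empty => simp
    | insert i s hi ih =>
      rw [Finset.prod_insert hi, Finset.prod_insert hi]
      refine (hstep i _).trans ?_
      rw [mul_assoc (2 * (k:ℝ) * α i) _ (μ.real S)]
      exact mul_le_mul_of_nonneg_left ih (by have := hαpos i; positivity)
  have hfinal := hprod Finset.univ
  have hS0 : 0 < μ S := (ENNReal.toReal_pos_iff.1 hSpos).1
  have hle : magRatio μ (∏ i, A i) B ≤ μ ((∏ i, A i) • S) / μ S :=
    sInf_le ⟨S, hSB, mS, hS0, rfl⟩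
  refine hle.trans ?_
  rw [ENNReal.div_le_iff hS0.ne' (measure_ne_top _ _)]
  have hconv : ENNReal.ofReal ((2 * k) ^ k) * ∏ i, (μ ((A i) • B) / μ B) =
      ENNReal.ofReal (∏ i, (2 * k * α i)) := by
    rw [Finset.prod_mul_distrib]
    simp only [Finset.prod_const, Finset.card_univ, Fintype.card_fin]
    rw [ENNReal.ofReal_mul (by positivity), ENNReal.ofReal_prod_of_nonneg
      (fun i _ => (hαpos i).le)]
    congr 1
    refine Finset.prod_congr rfl fun i _ => ?_
    rw [hα, ENNReal.ofReal_div_of_pos hBr, ofReal_measureReal, ofReal_measureReal]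
  rw [hconv, ← ofReal_measureReal (μ := μ) (s := S), ← ofReal_measureReal (μ := μ),
    ← ENNReal.ofReal_mul (Finset.prod_nonneg fun i _ => by have := hαpos i; positivity)]
  exact ENNReal.ofReal_le_ofReal hfinal

theorem magRatio_mul_le (μ : Measure X) [IsProbabilityMeasure μ] (A : Set G) (B S : Set X)
    (hSB : S ⊆ B) (hS : MeasurableSet S) : magRatio μ A B * μ S ≤ μ (A • S) := by
  rcases eq_or_ne (μ S) 0 with h | h
  · simp [h]
  · rw [← ENNReal.le_div_iff_mul_le (Or.inl h) (Or.inl (measure_ne_top _ _))]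
    exact sInf_le ⟨S, hSB, hS, pos_iff_ne_zero.2 h, rfl⟩

/-- The product action. -/
@[reducible] def prodAct (G : Type u) (X : Type v) [CommGroup G] [MulAction G X] :
    MulAction (G × G) (X × X) where
  smul g x := (g.1 • x.1, g.2 • x.2)
  one_smul x := Prod.ext (one_smul G x.1) (one_smul G x.2)
  mul_smul g h x := Prod.ext (mul_smul g.1 h.1 x.1) (mul_smul g.2 h.2 x.2)

attribute [local instance] prodAct

theorem prodAct_smul (g : G × G) (x : X × X) : g • x = (g.1 • x.1, g.2 • x.2) := rfl

theorem prodAct_set (A A' : Set G) (S T : Set X) :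
    (A ×ˢ A') • (S ×ˢ T) = (A • S) ×ˢ (A' • T) := by
  ext ⟨x, y⟩
  simp only [Set.mem_smul, Set.mem_prod, Prod.exists, prodAct_smul, Prod.mk.injEq]
  constructor
  · rintro ⟨a, b, ⟨ha, hb⟩, s, t, ⟨hs, ht⟩, rfl, rfl⟩
    exact ⟨⟨a, ha, s, hs, rfl⟩, ⟨b, hb, t, ht, rfl⟩⟩
  · rintro ⟨⟨a, ha, s, hs, rfl⟩, ⟨b, hb, t, ht, rfl⟩⟩
    exact ⟨a, b, ⟨ha, hb⟩, s, t, ⟨hs, ht⟩, rfl, rfl⟩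

theorem prod_hmeas (hmeas : ∀ g : G, Measurable (fun x : X => g • x)) (g : G × G) :
    Measurable (fun x : X × X => g • x) :=
  ((hmeas g.1).comp measurable_fst).prodMk ((hmeas g.2).comp measurable_snd)

theorem prod_hinv (μ : Measure X) [IsProbabilityMeasure μ]
    (hmeas : ∀ g : G, Measurable (fun x : X => g • x))
    (hinv : ∀ (g : G) (S : Set X), MeasurableSet S → μ (g • S) = μ S)
    (g : G × G) (S : Set (X × X)) (hS : MeasurableSet S) :
    (μ.prod μ) (g • S) = (μ.prod μ) S := by
  have hmp : ∀ g : G, MeasurePreserving (fun x : X => g • x) μ μ := by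
    intro g
    refine ⟨hmeas g, ?_⟩
    ext T hT
    rw [Measure.map_apply (hmeas g) hT, Set.preimage_smul, hinv _ _ hT]
  have h := (hmp g⁻¹.1).prod (hmp g⁻¹.2)
  have h2 := h.measure_preimage hS.nullMeasurableSet
  have h3 : Prod.map (fun x : X => g⁻¹.1 • x) (fun x : X => g⁻¹.2 • x) ⁻¹' S = g • S := by
    have := Set.preimage_smul g⁻¹ S
    rw [inv_inv] at this
    exact this
  rwa [h3] at h2

theorem magRatio_prod (μ : Measure X) [IsProbabilityMeasure μ]
    (hmeas : ∀ g : G, Measurable (fun x : X => g • x)) (A : Set G) (B : Set X) :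
    magRatio μ A B ^ 2 ≤ magRatio (μ.prod μ) (A ×ˢ A) (B ×ˢ B) := by
  refine le_sInf ?_
  rintro r ⟨Z, hZB, mZ, hZ0, rfl⟩
  rw [ENNReal.le_div_iff_mul_le (Or.inl hZ0.ne') (Or.inl (measure_ne_top _ _))]
  set Y : Set (X × X) := (({1} : Set G) ×ˢ A) • Z with hY
  have mY : MeasurableSet Y := meas_set_smul (prod_hmeas hmeas) _ mZ
  have hAA : (A ×ˢ A) • Z = (A ×ˢ ({1} : Set G)) • Y := by
    rw [hY, smul_smul, Set.prod_mul_prod_comm]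
    simp
  have mAA : MeasurableSet ((A ×ˢ A) • Z) := meas_set_smul (prod_hmeas hmeas) _ mZ
  have h1 : magRatio μ A B * (μ.prod μ) Z ≤ (μ.prod μ) Y := by
    rw [Measure.prod_apply mZ, Measure.prod_apply mY,
      ← lintegral_const_mul _ (measurable_measure_prodMk_left mZ)]
    refine lintegral_mono fun x => ?_
    have hs : Prod.mk x ⁻¹' Y = A • (Prod.mk x ⁻¹' Z) := by
      ext y
      simp only [hY, Set.mem_preimage, Set.mem_smul, Set.mem_prod, Prod.exists, prodAct_smul,
        Prod.mk.injEq, Set.mem_singleton_iff]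
      constructor
      · rintro ⟨a, b, ⟨rfl, hb⟩, s, t, hst, h1, rfl⟩
        rw [one_smul] at h1
        subst h1
        exact ⟨b, hb, t, hst, rfl⟩
      · rintro ⟨b, hb, t, ht, rfl⟩
        exact ⟨1, b, ⟨rfl, hb⟩, x, t, ht, one_smul _ _, rfl⟩
    simp only [hs]
    exact magRatio_mul_le μ A B _ (fun y hy => (hZB hy).2) (measurable_prodMk_left mZ)
  have hYB : ∀ p ∈ Y, p.1 ∈ B := by
    rintro p ⟨g, ⟨hg1, -⟩, z, hz, rfl⟩
    have hg1' : g.1 = 1 := hg1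
    change g.1 • z.1 ∈ B
    rw [hg1', one_smul]
    exact (hZB hz).1
  have h2 : magRatio μ A B * (μ.prod μ) Y ≤ (μ.prod μ) ((A ×ˢ A) • Z) := by
    rw [Measure.prod_apply_symm mAA, Measure.prod_apply_symm mY,
      ← lintegral_const_mul _ (measurable_measure_prodMk_right mY)]
    refine lintegral_mono fun y => ?_
    have hs : (fun x => (x, y)) ⁻¹' ((A ×ˢ A) • Z) = A • ((fun x => (x, y)) ⁻¹' Y) := by
      rw [hAA]
      ext x
      simp only [Set.mem_preimage, Set.mem_smul (s := A ×ˢ ({1} : Set G)),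
        Set.mem_smul (s := A), Set.mem_prod, Prod.exists, prodAct_smul,
        Prod.mk.injEq, Set.mem_singleton_iff]
      constructor
      · rintro ⟨a, b, ⟨ha, rfl⟩, s, t, hst, rfl, h1⟩
        rw [one_smul] at h1
        subst h1
        exact ⟨a, ha, s, hst, rfl⟩
      · rintro ⟨a, ha, s, hs, rfl⟩
        exact ⟨a, 1, ⟨ha, rfl⟩, s, y, hs, rfl, one_smul _ _⟩
    simp only [hs]
    exact magRatio_mul_le μ A B _ (fun x hx => hYB _ hx) (measurable_prodMk_right mY)
  calc magRatio μ A B ^ 2 * (μ.prod μ) Z = magRatio μ A B * (magRatio μ A B * (μ.prod μ) Z) := by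
        ring
    _ ≤ magRatio μ A B * (μ.prod μ) Y := by gcongr
    _ ≤ _ := h2

theorem prod_sets (k : ℕ) (A : Fin k → Set G) :
    ∏ i, ((A i) ×ˢ (A i)) = (∏ i, A i) ×ˢ (∏ i, A i) := by
  classical
  have : ∀ s : Finset (Fin k), ∏ i ∈ s, ((A i) ×ˢ (A i)) = (∏ i ∈ s, A i) ×ˢ (∏ i ∈ s, A i) := by
    intro s
    induction s using Finset.induction_on with
    | empty =>
      simp only [Finset.prod_empty, ← Set.singleton_one, Set.singleton_prod_singleton]
      rfl
    | insert i s hi ih =>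
      rw [Finset.prod_insert hi, Finset.prod_insert hi, ih, Set.prod_mul_prod_comm]
  exact this _

theorem tensor (k : ℕ) (hk : 0 < k) (m : ℕ) : ∀ (G : Type u) (X : Type v) [CommGroup G]
    [Countable G] [MulAction G X] [MeasurableSpace X] (μ : Measure X) [IsProbabilityMeasure μ]
    (_ : ∀ g : G, Measurable (fun x : X => g • x))
    (_ : ∀ (g : G) (S : Set X), MeasurableSet S → μ (g • S) = μ S)
    (A : Fin k → Set G) (_ : ∀ i, (A i).Nonempty) (B : Set X)
    (_ : MeasurableSet B) (_ : 0 < μ B),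
    magRatio μ (∏ i, A i) B ^ (2 ^ m) ≤
      ENNReal.ofReal ((2 * k) ^ k) * (∏ i, (μ ((A i) • B) / μ B)) ^ (2 ^ m) := by
  induction m with
  | zero =>
    intro G X _ _ _ _ μ _ hmeas hinv A hA B hB hB0
    simpa using weak_ineq μ hmeas hinv k hk A hA B hB hB0
  | succ m ih =>
    intro G X _ _ _ _ μ _ hmeas hinv A hA B hB hB0
    have h := ih (G × G) (X × X) (μ.prod μ) (prod_hmeas hmeas) (prod_hinv μ hmeas hinv)
      (fun i => A i ×ˢ A i) (fun i => (hA i).prod (hA i)) (B ×ˢ B) (hB.prod hB)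
      (by rw [Measure.prod_prod]; exact ENNReal.mul_pos hB0.ne' hB0.ne')
    have h1 := magRatio_prod μ hmeas (∏ i, A i) B
    rw [prod_sets] at h
    have h2 : ∏ i, ((μ.prod μ) ((A i ×ˢ A i) • (B ×ˢ B)) / (μ.prod μ) (B ×ˢ B)) =
        (∏ i, (μ ((A i) • B) / μ B)) ^ 2 := by
      rw [← Finset.prod_pow]
      refine Finset.prod_congr rfl fun i _ => ?_
      rw [prodAct_set, Measure.prod_prod, Measure.prod_prod, sq, div_eq_mul_inv, div_eq_mul_inv,
        ENNReal.mul_inv (Or.inl hB0.ne') (Or.inl (measure_ne_top _ _))]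
      ring
    rw [h2] at h
    rw [pow_succ 2 m, mul_comm (2 ^ m) 2, pow_mul, pow_mul]
    exact (pow_le_pow_left' h1 _).trans h

end helpers

/-- Plünnecke inequality for different summands in the dynamical setting: if a countable
abelian group `G` acts on a probability space `(X, 𝓑, μ)` with `L²(X, 𝓑, μ)` separable by
measure preserving maps, then for `A_1, …, A_k ⊆ G` and measurable `B` with `μ(B) > 0`,
`c(A_1 ⋯ A_k, B) ≤ ∏_{i=1}^k μ(A_i B)/μ(B)`. -/
theorem magRatio_different_summands {G X : Type*} [CommGroup G] [Countable G]
    [MulAction G X] [MeasurableSpace X] (μ : Measure X) [IsProbabilityMeasure μ]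
    (hsep : TopologicalSpace.SeparableSpace (MeasureTheory.Lp ℝ 2 μ))
    (hmeas : ∀ g : G, Measurable (fun x : X => g • x))
    (hinv : ∀ (g : G) (S : Set X), MeasurableSet S → μ (g • S) = μ S)
    (k : ℕ) (hk : 0 < k) (A : Fin k → Set G) (B : Set X)
    (hB : MeasurableSet B) (hB0 : 0 < μ B) :
    magRatio μ (∏ i, A i) B ≤ ∏ i, (μ ((A i) • B) / μ B) := by
  classical
  by_cases hA : ∀ i, (A i).Nonempty
  · have ht := fun m => tensor k hk m G X μ hmeas hinv A hA B hB hB0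
    set c := magRatio μ (∏ i, A i) B with hc
    set P := ∏ i, (μ ((A i) • B) / μ B) with hP
    have hPtop : P ≠ ⊤ := ENNReal.prod_ne_top fun i _ =>
      ENNReal.div_ne_top (measure_ne_top _ _) hB0.ne'
    have hctop : c ≠ ⊤ := by
      have h := ht 0
      simp only [pow_zero, pow_one] at h
      exact ne_top_of_le_ne_top (ENNReal.mul_ne_top ENNReal.ofReal_ne_top hPtop) h
    have hr : ∀ m : ℕ, c.toReal ^ (2 ^ m) ≤ (2 * k) ^ k * P.toReal ^ (2 ^ m) := by
      intro m
      have h := ENNReal.toReal_mono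
        (ENNReal.mul_ne_top ENNReal.ofReal_ne_top (ENNReal.pow_ne_top hPtop)) (ht m)
      rwa [ENNReal.toReal_mul, ENNReal.toReal_pow, ENNReal.toReal_pow,
        ENNReal.toReal_ofReal (by positivity)] at h
    rw [← ENNReal.toReal_le_toReal hctop hPtop]
    by_contra! hlt
    rcases (ENNReal.toReal_nonneg (a := P)).eq_or_lt with h0 | h0
    · have h := hr 0
      rw [← h0] at h hlt
      simp at h
      linarith
    · have h1 : 1 < c.toReal / P.toReal := (one_lt_div h0).2 hlt
      obtain ⟨n, hn⟩ := pow_unbounded_of_one_lt ((2 * k : ℝ) ^ k) h1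
      have h2 := pow_le_pow_right₀ h1.le (Nat.lt_two_pow_self (n := n)).le
      have h3 := hr n
      rw [← div_le_iff₀ (by positivity), ← div_pow] at h3
      linarith
  · push Not at hA
    obtain ⟨i, hi⟩ := hA
    have h0 : ∏ i, A i = ∅ := by
      rw [← Finset.mul_prod_erase _ _ (Finset.mem_univ i), hi, Set.empty_mul]
    have : magRatio μ (∏ i, A i) B ≤ 0 :=
      sInf_le ⟨B, le_rfl, hB, hB0, by rw [h0]; simp⟩
    exact this.trans bot_le
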